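/- Let V be a finite nonempty set, let next : V ⇀ V be a partial function, and let P ⊆ V be such that every v ∈ V is reachable from some p ∈ P by finitely many (possibly zero) applications of next. Then the number of elements v ∈ V having at least two next-predecessors, i.e. with |{ u ∈ V : next(u) = v }| ≥ 2, is at most |P|. In particular, the graph obtained by reversing all next edges of a program heap configuration with k pointer variables, in which every location is reachable from a location pointed to by a pointer variable, is a tree with at most k branching nodes. -/

import Mathlib

/-- The numbers of predecessors under a partial function sum to at most the number of elements. -/
lemma sum_card_predecessors_le {α β : Type*} [Fintype α] [Fintype β] [DecidableEq β]
    (f : α → Option β) :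
    ∑ v : β, (Finset.univ.filter fun u : α => f u = some v).card ≤ Fintype.card α := by
  simp only [Finset.card_filter]
  rw [Finset.sum_comm, Fintype.card_eq_sum_ones]
  refine Finset.sum_le_sum fun u _ => ?_
  rw [← Finset.card_filter, Finset.card_le_one]
  simp only [Finset.mem_filter, Finset.mem_univ, true_and]
  intro a ha b hb
  exact Option.some.inj (ha.symm.trans hb)


/-- in a finite nonempty set `V` with a partial successor function `next`
in which every element is reachable from the set `P`, the number of elements with at
least two `next`-predecessors is at most `|P|`.  (Hence the reversed heap of a program
configuration with `k` pointer variables is a tree with at most `k` branching nodes.) -/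
theorem branching_nodes_le_pointers (V : Type) [Fintype V] [Nonempty V] [DecidableEq V]
    (next : V → Option V) (P : Finset V)
    (hreach : ∀ v : V, ∃ p ∈ P,
      Relation.ReflTransGen (fun a b => next a = some b) p v) :
    (Finset.univ.filter fun v : V =>
        2 ≤ (Finset.univ.filter fun u : V => next u = some v).card).card ≤ P.card := by
  have pointwise (v : V) : 1 + (if 2 ≤ (Finset.univ.filter fun u : V => next u = some v).card
      then 1 else 0) ≤
      (Finset.univ.filter fun u : V => next u = some v).card + if v ∈ P then 1 else 0 := by
    have mem_or_pos : v ∈ P ∨ 0 < (Finset.univ.filter fun u : V => next u = some v).card := by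
      obtain ⟨p, hp, hpv⟩ := hreach v
      rcases hpv.cases_tail with rfl | ⟨u, -, hu⟩
      · exact Or.inl hp
      · exact Or.inr (Finset.card_pos.mpr ⟨u, by simpa using hu⟩)
    split_ifs <;> grind
  have total := Finset.sum_le_sum fun v (_ : v ∈ Finset.univ) => pointwise v
  rw [Finset.sum_add_distrib, Finset.sum_add_distrib, ← Fintype.card_eq_sum_ones,
    ← Finset.card_filter, ← Finset.card_filter, Finset.filter_univ_mem] at total
  have := sum_card_predecessors_le next
  omega
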